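/- arXiv:2112.07394 — 7 statements merged into one kernel-verified Lean document; each statement's English description precedes it below -/
import Mathlib

section
/- Let D be a division ring, k a positive integer, and let N be a k×k matrix over the Laurent power series ring D((t)) all of whose entries have order at least 0. Set M = Id + N·t. Then there exists a k×k lower-triangular matrix L over D((t)) with every diagonal entry equal to 1 such that the product L·M is upper triangular and every diagonal entry of L·M is of the form 1 + d·t for some Laurent series d of order at least 0 (equivalently, each diagonal entry of L·M has coefficient 1 at t^0 and coefficient 0 at t^j for every j < 0). -/
lemma ltr_aux {R S : Type*} [Ring R] [Ring S] (φ : R →+* S)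
    (h : ∀ a, φ a = 1 → ∃ b, b * a = 1) (k : ℕ) :
    ∀ M : Matrix (Fin k) (Fin k) R, (∀ i j, φ (M i j) = (1 : Matrix (Fin k) (Fin k) S) i j) →
    ∃ L : Matrix (Fin k) (Fin k) R,
      (∀ i j : Fin k, i < j → L i j = 0) ∧
      (∀ i : Fin k, L i i = 1) ∧
      (∀ i j : Fin k, j < i → (L * M) i j = 0) ∧
      (∀ i : Fin k, φ ((L * M) i i) = 1) := by
  induction k with
  | zero => exact fun M _ => ⟨0, fun i => i.elim0, fun i => i.elim0, fun i => i.elim0,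
      fun i => i.elim0⟩
  | succ k ih =>
    intro M hM
    obtain ⟨b, hb⟩ := h (M 0 0) (by simpa using hM 0 0)
    let M' : Matrix (Fin k) (Fin k) R := fun i j => M i.succ j.succ - M i.succ 0 * b * M 0 j.succ
    obtain ⟨L', h1, h2, h3, h4⟩ := ih M' (by
      intro i j
      have e1 := hM i.succ j.succ
      have e2 := hM i.succ 0
      rw [Matrix.one_apply_ne (Fin.succ_ne_zero i)] at e2
      simp only [M', map_sub, map_mul, e1, e2, zero_mul, sub_zero]
      simp [Matrix.one_apply])
    let L : Matrix (Fin (k+1)) (Fin (k+1)) R :=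
      fun i j => Fin.cases (Fin.cases 1 (fun _ => 0) j)
        (fun i => Fin.cases (- ∑ l, L' i l * (M l.succ 0 * b)) (fun j => L' i j) j) i
    have L00 : L 0 0 = 1 := rfl
    have L0s : ∀ j : Fin k, L 0 j.succ = 0 := fun _ => rfl
    have Ls0 : ∀ i : Fin k, L i.succ 0 = - ∑ l, L' i l * (M l.succ 0 * b) := fun _ => rfl
    have Lss : ∀ i j : Fin k, L i.succ j.succ = L' i j := fun _ _ => rfl
    have P0 : ∀ j, (L * M) 0 j = M 0 j := by
      intro j
      simp [Matrix.mul_apply, Fin.sum_univ_succ, L00, L0s]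
    have Ps0 : ∀ i : Fin k, (L * M) i.succ 0 = 0 := by
      intro i
      simp [Matrix.mul_apply, Fin.sum_univ_succ, Ls0, Lss, Finset.sum_mul, mul_assoc, hb]
    have hM' : ∀ i j, M' i j = M i.succ j.succ - M i.succ 0 * b * M 0 j.succ := fun _ _ => rfl
    have Pss : ∀ i j : Fin k, (L * M) i.succ j.succ = (L' * M') i j := by
      intro i j
      simp only [Matrix.mul_apply, Fin.sum_univ_succ, Ls0, Lss, Finset.sum_mul, mul_assoc, hM',
        mul_sub, Finset.sum_sub_distrib, neg_mul]
      abel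
    refine ⟨L, ?_, ?_, ?_, ?_⟩
    · intro i j hij
      cases j using Fin.cases with
      | zero => simp at hij
      | succ j =>
        cases i using Fin.cases with
        | zero => exact L0s j
        | succ i => rw [Lss]; exact h1 i j (by simpa using hij)
    · intro i
      cases i using Fin.cases with
      | zero => exact L00
      | succ i => rw [Lss]; exact h2 i
    · intro i j hij
      cases i using Fin.cases with
      | zero => simp at hij
      | succ i =>
        cases j using Fin.cases with
        | zero => exact Ps0 i
        | succ j => rw [Pss]; exact h3 i j (by simpa using hij)
    · intro i
      cases i using Fin.cases with
      | zero => rw [P0]; simpa using hM 0 0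
      | succ i => rw [Pss]; exact h4 i

lemma ofPS_neg {D : Type*} [Ring D] (f : PowerSeries D) (m : ℤ) (hm : m < 0) :
    (HahnSeries.ofPowerSeries ℤ D f).coeff m = 0 := by
  rw [HahnSeries.ofPowerSeries_apply]
  apply HahnSeries.embDomain_of_notMem_range
  rintro ⟨n, hn⟩
  have : (n : ℤ) = m := by simpa using hn
  omega

lemma ofPS_surj {D : Type*} [Ring D] (x : LaurentSeries D) (h : ∀ m : ℤ, m < 0 → x.coeff m = 0) :
    ∃ f : PowerSeries D, HahnSeries.ofPowerSeries ℤ D f = x := by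
  refine ⟨PowerSeries.mk fun n => x.coeff n, ?_⟩
  ext m
  rcases lt_or_ge m 0 with hm | hm
  · rw [ofPS_neg _ _ hm, h m hm]
  · lift m to ℕ using hm
    have := HahnSeries.ofPowerSeries_apply_coeff (Γ := ℤ) (PowerSeries.mk fun n => x.coeff n) m
    simpa using this

/-- Let `D` be a division ring, `k` a positive integer, and `N` a `k × k`
matrix over the Laurent power series ring `D((t))` all of whose entries have order at least `0`
(i.e. all coefficients at negative exponents vanish).  Set `M = Id + N·t`.  Then there is a
`k × k` lower-triangular matrix `L` over `D((t))` with all diagonal entries equal to `1` such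
that `L * M` is upper triangular and every diagonal entry of `L * M` has coefficient `1` at
`t^0` and coefficient `0` at `t^j` for every `j < 0`. -/
theorem matrix_one_add_t_reduction
    (D : Type*) [DivisionRing D] (k : ℕ) (hk : 0 < k)
    (N : Matrix (Fin k) (Fin k) (LaurentSeries D))
    (hN : ∀ i j : Fin k, ∀ m : ℤ, m < 0 → (N i j).coeff m = 0)
    (M : Matrix (Fin k) (Fin k) (LaurentSeries D))
    (hM : M = 1 + N * Matrix.scalar (Fin k) (HahnSeries.single (1 : ℤ) (1 : D))) :
    ∃ L : Matrix (Fin k) (Fin k) (LaurentSeries D),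
      (∀ i j : Fin k, i < j → L i j = 0) ∧
      (∀ i : Fin k, L i i = 1) ∧
      (∀ i j : Fin k, j < i → (L * M) i j = 0) ∧
      (∀ i : Fin k, ((L * M) i i).coeff 0 = 1 ∧
        ∀ m : ℤ, m < 0 → ((L * M) i i).coeff m = 0) := by

  choose n hn using fun i j => ofPS_surj (N i j) (hN i j)
  let M₀ : Matrix (Fin k) (Fin k) (PowerSeries D) := fun i j =>
    (1 : Matrix (Fin k) (Fin k) (PowerSeries D)) i j + n i j * PowerSeries.X
  have hM₀ : ∀ i j, M₀ i j = (1 : Matrix (Fin k) (Fin k) (PowerSeries D)) i j +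
    n i j * PowerSeries.X := fun _ _ => rfl
  have hMM : M = M₀.map (HahnSeries.ofPowerSeries ℤ D) := by
    ext1 i j
    rw [Matrix.map_apply, hM₀]
    simp only [hM, Matrix.add_apply, map_add, map_mul, hn,
      HahnSeries.ofPowerSeries_X, Matrix.scalar_apply, Matrix.mul_diagonal, Matrix.one_apply]
    split_ifs <;> simp
  obtain ⟨L, h1, h2, h3, h4⟩ := ltr_aux (PowerSeries.constantCoeff (R := D))
    (fun a ha => ⟨PowerSeries.invOfUnit a 1, PowerSeries.invOfUnit_mul a 1 (by simpa using ha)⟩) k M₀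
    (by
      intro i j
      simp only [hM₀, map_add, map_mul, PowerSeries.constantCoeff_X, mul_zero, add_zero,
        Matrix.one_apply]
      split_ifs <;> simp)
  refine ⟨L.map (HahnSeries.ofPowerSeries ℤ D), ?_⟩
  rw [hMM, ← Matrix.map_mul]
  refine ⟨fun i j hij => by simp [h1 i j hij], fun i => by simp [h2 i],
    fun i j hij => by simp only [Matrix.map_apply, h3 i j hij, map_zero], fun i => ⟨?_, fun m hm => ofPS_neg _ m hm⟩⟩
  have := HahnSeries.ofPowerSeries_apply_coeff (Γ := ℤ) ((L * M₀) i i) 0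
  rw [Matrix.map_apply]
  simpa [h4 i] using this
end

section
/- Let D be a division ring and D[t] the polynomial ring over D in one central variable. Assume D[t] satisfies the Ore condition and let D(t) = Ore(D[t]) be its Ore field of fractions, with canonical embedding ι : D[t] → D(t). Let σ : D → M_n(D) be a unital ring homomorphism and extend it coefficientwise to σ̂ : D[t] → M_n(D[t]) (for p = Σ_j d_j t^j, σ̂(p) is the matrix whose (i,i') entry is Σ_j (σ(d_j))_{ii'} t^j). Then for every nonzero polynomial p ∈ D[t], the matrix obtained by applying ι to every entry of σ̂(p) is invertible in M_n(D(t)). -/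
open scoped Polynomial

/-- The coefficientwise extension of a ring homomorphism `σ : D → M_n(D)` to polynomials:
for `p = Σ_j d_j t^j`, the `(i, i')` entry of `polyExt σ p` is the polynomial
`Σ_j (σ (d_j))_{i i'} t^j`. -/
noncomputable def polyExt {D : Type*} [DivisionRing D] {n : ℕ}
    (σ : D →+* Matrix (Fin n) (Fin n) D) (p : D[X]) :
    Matrix (Fin n) (Fin n) D[X] :=
  Matrix.of fun i i' => ∑ j ∈ p.support, Polynomial.monomial j (σ (p.coeff j) i i')

theorem polyExt_coeff_aux {D : Type*} [DivisionRing D] {n : ℕ}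
    (σ : D →+* Matrix (Fin n) (Fin n) D) (p : D[X]) (i j : Fin n) (k : ℕ) :
    (polyExt σ p i j).coeff k = σ (p.coeff k) i j := by
  simp only [polyExt, Matrix.of_apply, Polynomial.finsetSum_coeff, Polynomial.coeff_monomial]
  rw [Finset.sum_ite_eq' p.support k]
  split_ifs with h
  · rfl
  · rw [Polynomial.notMem_support_iff.mp h]; simp

theorem vecMul_polyExt_inj {D : Type*} [DivisionRing D] {n : ℕ}
    (σ : D →+* Matrix (Fin n) (Fin n) D) (p : D[X]) (hp : p ≠ 0) (r : Fin n → D[X])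
    (h : Matrix.vecMul r (polyExt σ p) = 0) : r = 0 := by
  classical
  by_contra hr
  obtain ⟨i0, hi0⟩ : ∃ i, r i ≠ 0 := by
    by_contra! hc
    exact hr (funext hc)
  obtain ⟨i1, hi1, hmax⟩ := Finset.exists_max_image (Finset.univ.filter fun i => r i ≠ 0)
    (fun i => (r i).natDegree) ⟨i0, by simp [hi0]⟩
  have hi1' : r i1 ≠ 0 := by simpa using hi1
  set N := (r i1).natDegree with hN
  have hdeg : ∀ i, (r i).natDegree ≤ N := by
    intro i
    by_cases hi : r i = 0
    · simp [hi]
    · exact hmax i (by simp [hi])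
  have hM : ∀ i j, (polyExt σ p i j).natDegree ≤ p.natDegree := by
    intro i j
    rw [Polynomial.natDegree_le_iff_coeff_eq_zero]
    intro k hk
    rw [polyExt_coeff_aux, Polynomial.coeff_eq_zero_of_natDegree_lt hk]; simp
  have key : Matrix.vecMul (fun i => (r i).coeff N) (σ p.leadingCoeff) = 0 := by
    funext j
    have := congrArg (fun q => Polynomial.coeff q (N + p.natDegree)) (congrFun h j)
    simp only [Matrix.vecMul, dotProduct, Polynomial.finsetSum_coeff, Pi.zero_apply,
      Polynomial.coeff_zero] at this ⊢
    rw [← this]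
    refine Finset.sum_congr rfl fun i _ => ?_
    rw [Polynomial.coeff_mul_add_eq_of_natDegree_le (hdeg i) (hM i j), polyExt_coeff_aux]
    rfl
  have h1 : σ p.leadingCoeff * σ p.leadingCoeff⁻¹ = 1 := by
    rw [← map_mul, mul_inv_cancel₀ (Polynomial.leadingCoeff_ne_zero.mpr hp), map_one]
  have h2 := congrArg (fun v => Matrix.vecMul v (σ p.leadingCoeff⁻¹)) key
  simp only [Matrix.vecMul_vecMul, h1, Matrix.vecMul_one, Matrix.zero_vecMul] at h2
  exact hi1' (Polynomial.leadingCoeff_eq_zero.mp (congrFun h2 i1))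

theorem ore_common_denom {R : Type*} [Ring R] (S : Submonoid R) [OreLocalization.OreSet S]
    {ι : Type*} (v : ι → OreLocalization S R) (F : Finset ι) :
    ∃ s : S, ∀ i ∈ F, ∃ r : R, (OreLocalization.numeratorRingHom (s : R) : OreLocalization S R) * v i
      = OreLocalization.numeratorRingHom r := by
  classical
  induction F using Finset.induction_on with
  | empty => exact ⟨1, by simp⟩
  | insert a F _ ih =>
    obtain ⟨s, hs⟩ := ih
    obtain ⟨b, t, hv⟩ : ∃ (b : R) (t : S), (OreLocalization.numeratorRingHom (t : R) :
        OreLocalization S R) * v a = OreLocalization.numeratorRingHom b := by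
      induction hx : v a using OreLocalization.ind with
      | _ b t =>
        refine ⟨b, t, ?_⟩
        exact OreLocalization.mul_cancel
    have e := OreLocalization.ore_eq (t : R) s
    refine ⟨OreLocalization.oreDenom (t : R) s * t, ?_⟩
    intro i hi
    rcases Finset.mem_insert.mp hi with rfl | hi
    · refine ⟨OreLocalization.oreDenom (t : R) s * b, ?_⟩
      rw [Submonoid.coe_mul, map_mul, mul_assoc, hv, map_mul]
    · obtain ⟨r, hr⟩ := hs i hi
      refine ⟨OreLocalization.oreNum (t : R) s * r, ?_⟩
      rw [Submonoid.coe_mul, e, map_mul, mul_assoc, hr, map_mul]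

/-- Let `D` be a division ring whose polynomial ring `D[t]` satisfies the Ore
condition (the nonzero elements, i.e. the non-zero-divisors, form an Ore set), and let
`D(t) = Ore(D[t])` be the Ore field of fractions with canonical embedding `ι`.  Let
`σ : D → M_n(D)` be a unital ring homomorphism, extended coefficientwise to
`σ̂ : D[t] → M_n(D[t])`.  Then for every nonzero `p ∈ D[t]`, applying `ι` entrywise to
`σ̂ p` yields an invertible matrix in `M_n(D(t))`. -/
theorem polyExt_isUnit_in_oreLocalization
    (D : Type*) [DivisionRing D] (n : ℕ) (hn : 0 < n)
    [OreLocalization.OreSet (nonZeroDivisors D[X])]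
    (σ : D →+* Matrix (Fin n) (Fin n) D)
    (p : D[X]) (hp : p ≠ 0) :
    IsUnit ((polyExt σ p).map
      (OreLocalization.numeratorRingHom :
        D[X] →+* OreLocalization (nonZeroDivisors D[X]) D[X])) := by
  set ι := (OreLocalization.numeratorRingHom :
        D[X] →+* OreLocalization (nonZeroDivisors D[X]) D[X]) with hι
  set M := (polyExt σ p).map ι with hM
  have hinjι : Function.Injective ι :=
    OreLocalization.numeratorHom_inj inf_le_left
  have hinj : Function.Injective (Matrix.vecMulLinear M) := by
    rw [← LinearMap.ker_eq_bot, LinearMap.ker_eq_bot']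
    intro v hv
    obtain ⟨s, hs⟩ := ore_common_denom (nonZeroDivisors D[X]) v Finset.univ
    choose r hr using fun i => hs i (Finset.mem_univ i)
    have hs0 : ι (s : D[X]) ≠ 0 := by
      rw [Ne, map_eq_zero_iff _ hinjι]
      exact nonZeroDivisors.coe_ne_zero s
    have hr0 : r = 0 := by
      apply vecMul_polyExt_inj σ p hp
      funext j
      apply hinjι
      have hj := congrFun hv j
      simp only [Matrix.vecMulLinear_apply, Matrix.vecMul, dotProduct, Pi.zero_apply, hM,
        Matrix.map_apply] at hj ⊢
      rw [map_sum, map_zero, ← mul_zero (ι (s : D[X])), ← hj, Finset.mul_sum]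
      refine Finset.sum_congr rfl fun i _ => ?_
      rw [map_mul, ← hr, mul_assoc]
    funext i
    have := hr i
    rw [hr0, Pi.zero_apply, map_zero] at this
    exact (mul_eq_zero.mp this).resolve_left hs0
  have hsurj := LinearMap.injective_iff_surjective.mp hinj
  choose N hN using fun i => hsurj (Pi.single i 1)
  have hNM : Matrix.of N * M = 1 := by
    ext i j
    have := congrFun (hN i) j
    rw [Matrix.one_apply, Matrix.mul_apply]
    simp only [Matrix.vecMulLinear_apply, Matrix.vecMul, dotProduct, Pi.single_apply] at this
    simp only [Matrix.of_apply, this, eq_comm]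
  exact IsUnit.of_mul_eq_one_right _ hNM
end

section
/- Let D be a division ring and D[t] the polynomial ring over D in one central variable; assume D[t] satisfies the Ore condition and let D(t) = Ore(D[t]) be its Ore field of fractions, with canonical embedding ι : D[t] → D(t) applied entrywise to matrices. Then every n×n matrix A over D[t] that is a non-zero-divisor in the ring M_n(D[t]) becomes invertible in M_n(D(t)). -/
open scoped Polynomial

theorem aux_common_denom {R : Type*} [Ring R] (S : Submonoid R) [OreLocalization.OreSet S]
    {ι : Type*} (f : ι → OreLocalization S R) (T : Finset ι) :
    ∃ s : S, ∀ i ∈ T, ∃ r : R,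
      (OreLocalization.numeratorRingHom (s : R) : OreLocalization S R) * f i =
        OreLocalization.numeratorRingHom r := by
  classical
  induction T using Finset.induction_on with
  | empty => exact ⟨1, by simp⟩
  | insert a T ha ih =>
    obtain ⟨s, hs⟩ := ih
    obtain ⟨t, r, htr⟩ : ∃ (t : S) (r : R),
        (OreLocalization.numeratorRingHom (t : R) : OreLocalization S R) *
          (OreLocalization.numeratorRingHom (s : R) * f a) =
          OreLocalization.numeratorRingHom r := by
      generalize (OreLocalization.numeratorRingHom (s : R) * f a) = x
      induction x using OreLocalization.ind with
      | _ r t => exact ⟨t, r, OreLocalization.mul_cancel⟩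
    refine ⟨t * s, fun i hi => ?_⟩
    rcases Finset.mem_insert.1 hi with rfl | hi
    · exact ⟨r, by rw [Submonoid.coe_mul, map_mul, mul_assoc, htr]⟩
    · obtain ⟨q, hq⟩ := hs i hi
      exact ⟨t * q, by rw [Submonoid.coe_mul, map_mul, mul_assoc, hq, map_mul]⟩

theorem aux_isUnit {K : Type*} [DivisionRing K] {n : ℕ} (B : Matrix (Fin n) (Fin n) K)
    (h : ∀ v : Fin n → K, Matrix.vecMul v B = 0 → v = 0) : IsUnit B := by
  have hinj : Function.Injective (Matrix.vecMulLinear B) := by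
    rw [injective_iff_map_eq_zero]
    exact fun v hv => h v hv
  have hsurj : Function.Surjective (Matrix.vecMulLinear B) :=
    LinearMap.injective_iff_surjective.1 hinj
  choose C hC using fun i : Fin n => hsurj ((1 : Matrix (Fin n) (Fin n) K) i)
  have hCB : (Matrix.of C) * B = 1 := by
    ext i j
    exact congrFun (hC i) j
  exact ⟨⟨B, Matrix.of C, mul_eq_one_symm hCB, hCB⟩, rfl⟩

/-- Let `D` be a division ring whose polynomial ring `D[t]` satisfies the Ore
condition, with Ore field of fractions `D(t) = Ore(D[t])` and canonical embedding `ι` applied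
entrywise to matrices.  Then every `n × n` matrix over `D[t]` that is a non-zero-divisor in
`M_n(D[t])` becomes invertible in `M_n(D(t))`. -/
theorem matrix_nonZeroDivisor_isUnit_in_oreLocalization
    (D : Type*) [DivisionRing D] (n : ℕ) (hn : 0 < n)
    [OreLocalization.OreSet (nonZeroDivisors D[X])]
    (A : Matrix (Fin n) (Fin n) D[X])
    (hA : A ∈ nonZeroDivisors (Matrix (Fin n) (Fin n) D[X])) :
    IsUnit (A.map
      (OreLocalization.numeratorRingHom :
        D[X] →+* OreLocalization (nonZeroDivisors D[X]) D[X])) := by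
  have hι : Function.Injective (OreLocalization.numeratorRingHom :
        D[X] →+* OreLocalization (nonZeroDivisors D[X]) D[X]) :=
    OreLocalization.numeratorHom_inj inf_le_left
  apply aux_isUnit
  intro v hv
  obtain ⟨s, hs⟩ := aux_common_denom (nonZeroDivisors D[X]) v Finset.univ
  choose w hw using fun i => hs i (Finset.mem_univ i)
  have hwA : (Matrix.of fun _ : Fin n => w) * A = 0 := by
    ext1 i j
    apply hι
    have := congrFun hv j
    simp only [Matrix.vecMul, dotProduct, Matrix.map_apply, Pi.zero_apply] at this
    simp only [Matrix.mul_apply, Matrix.of_apply, Matrix.zero_apply, map_sum, map_mul, map_zero,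
      ← hw, mul_assoc]
    rw [← Finset.mul_sum, this, mul_zero]
  have h0 := (mem_nonZeroDivisors_iff.1 hA).2 _ hwA
  funext i
  have hwi : w i = 0 := congrFun (congrFun h0 ⟨0, hn⟩) i
  have h1 := hw i
  rw [hwi, map_zero] at h1
  have hu : IsUnit (OreLocalization.numeratorRingHom (s : D[X]) :
      OreLocalization (nonZeroDivisors D[X]) D[X]) := OreLocalization.numerator_isUnit s
  exact (hu.mul_right_eq_zero).1 h1
end

section
/- Let D be a division ring and D[t] the polynomial ring over D in one central variable; assume D[t] satisfies the Ore condition and let D(t) = Ore(D[t]) be its Ore field of fractions; let ι_n : M_n(D[t]) → M_n(D(t)) be the entrywise localization map. Then for every ring R and every ring homomorphism φ : M_n(D[t]) → R such that φ(A) is a unit of R for every non-zero-divisor A of the ring M_n(D[t]), there exists a unique ring homomorphism ψ : M_n(D(t)) → R with ψ ∘ ι_n = φ. -/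
open scoped Polynomial

/-- Let `D` be a division ring whose polynomial ring `D[t]` satisfies the Ore
condition, with Ore field of fractions `D(t) = Ore(D[t])`, and let
`ι_n : M_n(D[t]) → M_n(D(t))` be the entrywise localization map.  Then for every ring `R` and
every ring homomorphism `φ : M_n(D[t]) → R` sending every non-zero-divisor of `M_n(D[t])` to a
unit of `R`, there is a unique ring homomorphism `ψ : M_n(D(t)) → R` with `ψ ∘ ι_n = φ`. -/
theorem matrix_oreLocalization_universal_property
    (D : Type*) [DivisionRing D] (n : ℕ) (hn : 0 < n)
    [OreLocalization.OreSet (nonZeroDivisors D[X])]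
    (R : Type*) [Ring R]
    (φ : Matrix (Fin n) (Fin n) D[X] →+* R)
    (hφ : ∀ A ∈ nonZeroDivisors (Matrix (Fin n) (Fin n) D[X]), IsUnit (φ A)) :
    ∃! ψ : Matrix (Fin n) (Fin n) (OreLocalization (nonZeroDivisors D[X]) D[X]) →+* R,
      ψ.comp
        (RingHom.mapMatrix
          (OreLocalization.numeratorRingHom :
            D[X] →+* OreLocalization (nonZeroDivisors D[X]) D[X])) = φ := by
  classical
  let S := nonZeroDivisors D[X]
  have hscalar : ∀ s ∈ S, Matrix.scalar (Fin n) s ∈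
      nonZeroDivisors (Matrix (Fin n) (Fin n) D[X]) := by
    intro s hs
    have hs0 : s ≠ 0 := nonZeroDivisors.ne_zero hs
    rw [mem_nonZeroDivisors_iff]
    constructor
    · intro A hA
      ext1 i j
      have h := congrFun (congrFun hA i) j
      rw [Matrix.scalar_apply, Matrix.diagonal_mul] at h
      simpa [hs0] using h
    · intro A hA
      ext1 i j
      have h := congrFun (congrFun hA i) j
      rw [Matrix.scalar_apply, Matrix.mul_diagonal] at h
      simpa [hs0] using h
  let f : D[X] →+* R := φ.comp (Matrix.scalar (Fin n))
  have hfu : ∀ s : S, IsUnit ((f : D[X] →* R).comp S.subtype s) := fun s =>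
    hφ _ (hscalar s s.2)
  let fS : S →* Rˣ := IsUnit.liftRight ((f : D[X] →* R).comp S.subtype) hfu
  have hfS : ∀ s : S, f s = fS s := fun s => rfl
  let g : OreLocalization S D[X] →+* R := OreLocalization.universalHom f fS hfS
  have hg : ∀ r, g (OreLocalization.numeratorHom r) = f r := fun r =>
    OreLocalization.universalHom_commutes f fS hfS
  let e : Fin n → Fin n → R := fun i j => φ (Matrix.single i j 1)
  have hef : ∀ i j r, Commute (e i j) (f r) := by
    intro i j r
    change φ _ * φ _ = φ _ * φ _
    rw [← map_mul, ← map_mul]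
    congr 1
    ext1 a b
    rw [Matrix.scalar_apply, Matrix.mul_diagonal, Matrix.diagonal_mul]
    by_cases h : i = a ∧ j = b <;> simp [Matrix.single_apply, h]
  have heg : ∀ i j x, Commute (e i j) (g x) := by
    intro i j x
    induction x using OreLocalization.ind with
    | _ r s =>
      change Commute _ (OreLocalization.universalHom f fS hfS _)
      rw [OreLocalization.universalHom_apply]
      refine Commute.mul_right (Commute.units_inv_right ?_) (hef i j r)
      rw [← hfS]
      exact hef i j s
  have hee : ∀ i j k l, e i j * e k l = if j = k then e i l else 0 := by
    intro i j k l
    change φ _ * φ _ = _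
    rw [← map_mul]
    split_ifs with h
    · subst h
      simp [e]
    · rw [Matrix.single_mul_single_of_ne _ _ _ _ h, map_zero]
  have hone : ∑ i, e i i = 1 := by
    rw [← map_sum, ← map_one φ]
    congr 1
    ext1 a b
    rw [Matrix.sum_apply]
    by_cases h : a = b
    · subst h
      simp [Matrix.single_apply]
    · rw [Matrix.one_apply_ne h]
      refine Finset.sum_eq_zero fun i _ => ?_
      rw [Matrix.single_apply, if_neg]
      rintro ⟨rfl, h'⟩
      exact h h'
  let ψ : Matrix (Fin n) (Fin n) (OreLocalization S D[X]) →+* R :=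
    { toFun := fun A => ∑ i, ∑ j, g (A i j) * e i j
      map_zero' := by simp
      map_one' := by
        rw [← hone]
        refine Finset.sum_congr rfl fun i _ => ?_
        rw [Finset.sum_eq_single i]
        · simp
        · intro j _ hj
          simp [Matrix.one_apply_ne hj.symm]
        · simp
      map_add' := fun A B => by
        simp [add_mul, Finset.sum_add_distrib]
      map_mul' := fun A B => by
        have key : ∀ i j k l, g (A i j) * e i j * (g (B k l) * e k l) =
            if j = k then g (A i j) * g (B k l) * e i l else 0 := by
          intro i j k l
          rw [mul_assoc, ← mul_assoc (e i j), (heg i j _).eq, mul_assoc, hee]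
          split_ifs <;> simp [mul_assoc]
        simp only [Matrix.mul_apply, map_sum, map_mul, Finset.sum_mul]
        simp only [Finset.mul_sum, key]
        refine Finset.sum_congr rfl fun i _ => ?_
        rw [Finset.sum_comm]
        refine Finset.sum_congr rfl fun j _ => ?_
        rw [Finset.sum_comm]
        refine Finset.sum_congr rfl fun l _ => ?_
        simp }
  have hdec : ∀ {T : Type _} [Ring T] (A : Matrix (Fin n) (Fin n) T),
      A = ∑ i, ∑ j, Matrix.scalar (Fin n) (A i j) * Matrix.single i j 1 := by
    intro T _ A
    conv_lhs => rw [Matrix.matrix_eq_sum_single A]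
    refine Finset.sum_congr rfl fun i _ => Finset.sum_congr rfl fun j _ => ?_
    ext1 a b
    rw [Matrix.scalar_apply, Matrix.diagonal_mul]
    by_cases h : i = a ∧ j = b <;> simp [Matrix.single_apply, h]
  have hnum : ∀ r : D[X], (OreLocalization.numeratorRingHom :
      D[X] →+* OreLocalization (nonZeroDivisors D[X]) D[X]) r =
        OreLocalization.numeratorHom r := fun r => rfl
  refine ⟨ψ, ?_, ?_⟩
  · ext1 A
    conv_rhs => rw [hdec A]
    rw [map_sum φ]
    change ∑ i, ∑ j, g (OreLocalization.numeratorHom (A i j)) * e i j = _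
    refine Finset.sum_congr rfl fun i _ => ?_
    rw [map_sum φ]
    refine Finset.sum_congr rfl fun j _ => ?_
    rw [map_mul φ]
    congr 1
    exact hg (A i j)
  · intro χ hχ
    have hχ' : ∀ A, χ (RingHom.mapMatrix (OreLocalization.numeratorRingHom :
            D[X] →+* OreLocalization (nonZeroDivisors D[X]) D[X]) A) = φ A := fun A =>
      congrArg (fun h => h A) hχ
    have h1 : χ.comp (Matrix.scalar (Fin n)) = g := by
      refine OreLocalization.universalHom_unique f fS hfS _ fun r => ?_
      refine Eq.trans ?_ (hχ' (Matrix.scalar (Fin n) r))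
      change χ _ = χ _
      congr 1
      ext1 a b
      by_cases h : a = b <;> simp [Matrix.diagonal_apply, h, hnum]
    have h2 : ∀ i j, χ (Matrix.single i j 1) = e i j := by
      intro i j
      refine Eq.trans ?_ (hχ' (Matrix.single i j 1))
      congr 1
      ext1 a b
      by_cases h : i = a ∧ j = b <;> simp [h, OreLocalization.one_def]
    ext1 A
    conv_lhs => rw [hdec A]
    rw [map_sum]
    refine Finset.sum_congr rfl fun i _ => ?_
    rw [map_sum]
    refine Finset.sum_congr rfl fun j _ => ?_
    rw [map_mul, h2]
    congr 1
    exact congrArg (fun h => h (A i j)) h1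
end

section
/- Let E be a division ring and E[t] the polynomial ring over E in one central variable; assume E[t] satisfies the Ore condition and let E(t) = Ore(E[t]) be its Ore field of fractions, with canonical embedding ι : E[t] → E(t). Then there exists an injective ring homomorphism α : E(t) → E((t)) into the ring of formal Laurent power series such that α(ι(p)) = p for every polynomial p ∈ E[t], where every polynomial is regarded as a Laurent power series in the obvious way. -/
open scoped Polynomial

/-- A polynomial regarded as a Laurent power series in the obvious way. -/
noncomputable def polyToLaurentSeries {E : Type*} [DivisionRing E] (p : E[X]) :
    LaurentSeries E :=
  HahnSeries.ofPowerSeries ℤ E (PowerSeries.mk fun m => p.coeff m)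

/-- Every nonzero power series over a division ring becomes a unit among Laurent series. -/
theorem isUnit_ofPowerSeries_of_ne_zero {E : Type*} [DivisionRing E] {f : PowerSeries E}
    (hf : f ≠ 0) : IsUnit (HahnSeries.ofPowerSeries ℤ E f) := by
  rw [← PowerSeries.X_pow_order_mul_divXPowOrder (f := f), map_mul,
    HahnSeries.ofPowerSeries_X_pow]
  refine IsUnit.mul ?_ (IsUnit.map _ ?_)
  · refine ⟨⟨HahnSeries.single _ 1, HahnSeries.single (-(f.order.toNat : ℤ)) 1, ?_, ?_⟩, rfl⟩
    · simp [HahnSeries.single_mul_single]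
    · simp [HahnSeries.single_mul_single]
  · rw [PowerSeries.isUnit_iff_constantCoeff, isUnit_iff_ne_zero, Ne,
      PowerSeries.constantCoeff_divXPowOrder_eq_zero_iff]
    exact hf

/-- Let `E` be a division ring whose polynomial ring `E[t]` satisfies the Ore
condition, with Ore field of fractions `E(t) = Ore(E[t])` and canonical embedding `ι`.  Then
there is an injective ring homomorphism `α : E(t) → E((t))` into the ring of formal Laurent
power series such that `α (ι p) = p` for every polynomial `p`, where polynomials are regarded
as Laurent power series in the obvious way. -/
theorem oreLocalization_embeds_into_laurentSeries
    (E : Type*) [DivisionRing E]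
    [OreLocalization.OreSet (nonZeroDivisors E[X])] :
    ∃ α : OreLocalization (nonZeroDivisors E[X]) E[X] →+* LaurentSeries E,
      Function.Injective α ∧
      ∀ p : E[X], α (OreLocalization.numeratorRingHom p) = polyToLaurentSeries p := by
  let f : E[X] →+* LaurentSeries E :=
    (HahnSeries.ofPowerSeries ℤ E).comp Polynomial.coeToPowerSeries.ringHom
  have hu : ∀ s : nonZeroDivisors E[X],
      IsUnit ((f : E[X] →* LaurentSeries E).comp (nonZeroDivisors E[X]).subtype s) := by
    intro s
    refine isUnit_ofPowerSeries_of_ne_zero ?_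
    have h : (s : E[X]) ≠ 0 := nonZeroDivisors.coe_ne_zero s
    simpa using h
  refine ⟨OreLocalization.universalHom f (IsUnit.liftRight _ hu) (fun s => rfl), ?_, ?_⟩
  · exact RingHom.injective _
  · intro p
    refine (OreLocalization.universalHom_commutes f _ _).trans ?_
    simp only [f, polyToLaurentSeries, RingHom.comp_apply]
    congr 1
end

section
/- Let G be a finitely generated group whose maximal free abelian quotient G_fab is nontrivial, with canonical projection q : G → G_fab. Let D be a division ring, n a positive integer, and σ : G → GL_n(D) a group homomorphism. Assume the group ring D[G_fab] satisfies the Ore condition and let K = Ore(D[G_fab]) be its Ore field of fractions. Let G act on the column space K^n by g·v = σ(g)q(g)·v, i.e., by left multiplication by the n×n matrix over K whose (i,j) entry is σ(g)_{ij}·q(g) (viewing elements of G_fab inside K via the group ring and the localization embedding). Then the additive subgroup of K^n generated by the set {v − g·v : g ∈ G, v ∈ K^n} is all of K^n (equivalently, the zeroth homology of G with these coefficients vanishes: b_0^{σ⊗q}(G) = 0). -/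
namespace TwistedAux
open OreLocalization

theorem commonDen {R : Type*} [Ring R] {S : Submonoid R} [OreSet S] {ι : Type*} 
    (w : ι → OreLocalization S R) (F : Finset ι) :
    ∃ s : S, ∀ i ∈ F, ∃ r : R,
      (numeratorRingHom (s : R) : OreLocalization S R) * w i = numeratorRingHom r := by
  classical
  induction F using Finset.induction_on with
  | empty => exact ⟨1, by simp⟩
  | insert a F ha ih =>
    obtain ⟨s, hs⟩ := ih
    induction h : w a using OreLocalization.ind with
    | _ r0 s0 =>
    refine ⟨oreDenom (s : R) s0 * s, fun i hi => ?_⟩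
    rcases Finset.mem_insert.1 hi with rfl | hi
    · refine ⟨oreNum (s : R) s0 * r0, ?_⟩
      rw [Submonoid.coe_mul, ore_eq, map_mul, map_mul, mul_assoc, h]
      congr 1
      exact OreLocalization.mul_cancel
    · obtain ⟨r, hr⟩ := hs i hi
      exact ⟨oreDenom (s : R) s0 * r, by rw [Submonoid.coe_mul, map_mul, map_mul, mul_assoc, hr]⟩

theorem rowZero {D Q : Type*} [DivisionRing D] [CommGroup Q] [IsMulTorsionFree Q] {n : ℕ}
    (A : (Matrix (Fin n) (Fin n) D)ˣ) (t : Q) (ht : t ≠ 1) (r : Fin n → MonoidAlgebra D Q)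
    (h : ∀ j, r j = ∑ i, r i * MonoidAlgebra.single t (A.val i j)) : r = 0 := by
  classical
  let ρ : Q → Fin n → D := fun x i => (r i).coeff x
  have h1 : ∀ x, ρ (x * t) = Matrix.vecMul (ρ x) A.val := by
    intro x
    ext j
    simp only [ρ, Matrix.vecMul, dotProduct]
    conv_lhs => rw [h j]
    simp
  have h2 : ∀ x, ρ x ≠ 0 → ρ (x * t) ≠ 0 := by
    intro x hx h0
    apply hx
    rw [h1] at h0
    have := congrArg (fun v => Matrix.vecMul v (A⁻¹).val) h0
    simpa [Matrix.vecMul_vecMul] using this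
  have hfin : {x | ρ x ≠ 0}.Finite := by
    refine (Finset.finite_toSet (Finset.univ.biUnion fun i => (r i).coeff.support)).subset ?_
    intro x hx
    obtain ⟨i, hi⟩ := Function.ne_iff.1 hx
    simp only [Finset.coe_biUnion, Set.mem_iUnion]
    exact ⟨i, by simp, by simpa [ρ] using hi⟩
  by_contra hr
  obtain ⟨i, hi⟩ := Function.ne_iff.1 hr
  have : ∃ x, ρ x ≠ 0 := by
    by_contra! hx
    apply hi
    ext x
    exact congrFun (hx x) i
  obtain ⟨x, hx⟩ := this
  have h3 : ∀ k : ℕ, ρ (x * t ^ k) ≠ 0 := by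
    intro k
    induction k with
    | zero => simpa using hx
    | succ k ih => rw [pow_succ, ← mul_assoc]; exact h2 _ ih
  have hinj : Function.Injective fun k : ℕ => x * t ^ k := by
    intro a b hab
    exact IsMulTorsionFree.pow_right_injective ht (mul_left_cancel hab)
  exact Set.infinite_of_injective_forall_mem hinj h3 hfin

theorem surj {K : Type*} [DivisionRing K] {n : ℕ} (M : Matrix (Fin n) (Fin n) K)
    (h : ∀ w, Matrix.vecMul w M = 0 → w = 0) (v : Fin n → K) : ∃ u, Matrix.mulVec M u = v := by
  let f : (Fin n → K) →ₗ[K] (Fin n → K) := Matrix.toLinearMapRight' M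
  have hf : Function.Injective f := (injective_iff_map_eq_zero f).2 fun w hw => h w hw
  have hs := LinearMap.injective_iff_surjective.1 hf
  choose N hN using fun i => hs (Pi.single i 1)
  have h1 : (Matrix.of N) * M = 1 := by
    ext i j
    have := congrFun (hN i) j
    simp only [Pi.single_apply, eq_comm (a := j)] at this
    rw [Matrix.one_apply]
    exact this
  have h2 : M * Matrix.of N = 1 := mul_eq_one_comm.1 h1
  exact ⟨Matrix.mulVec (Matrix.of N) v, by rw [Matrix.mulVec_mulVec, h2, Matrix.one_mulVec]⟩

theorem main {D Q : Type*} [DivisionRing D] [CommGroup Q] [Group.FG Q] [IsMulTorsionFree Q] {n : ℕ}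
    [OreSet (nonZeroDivisors (MonoidAlgebra D Q))]
    (A : (Matrix (Fin n) (Fin n) D)ˣ) (t : Q) (ht : t ≠ 1)
    (w : Fin n → OreLocalization (nonZeroDivisors (MonoidAlgebra D Q)) (MonoidAlgebra D Q)) :
    ∃ v, w = v - Matrix.mulVec (Matrix.of fun i j =>
      numeratorRingHom (MonoidAlgebra.single t (A.val i j))) v := by
  have : Monoid.FG Q := Group.fg_iff_monoid_fg.1 inferInstance
  set B : Matrix (Fin n) (Fin n) (OreLocalization (nonZeroDivisors (MonoidAlgebra D Q)) (MonoidAlgebra D Q)) := Matrix.of fun i j =>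
      numeratorRingHom (MonoidAlgebra.single t (A.val i j)) with hB
  obtain ⟨u, hu⟩ := surj (1 - B) (fun w hw => by
    obtain ⟨s, hs⟩ := commonDen w Finset.univ
    choose r hr using fun i => hs i (Finset.mem_univ i)
    rw [Matrix.vecMul_sub, Matrix.vecMul_one, sub_eq_zero] at hw
    have hinj := numeratorHom_inj (R := MonoidAlgebra D Q) (S := nonZeroDivisors (MonoidAlgebra D Q)) inf_le_left
    have hr0 : r = 0 := rowZero A t ht r fun j => hinj (by
      change numeratorRingHom (r j) = numeratorRingHom (∑ i, r i * MonoidAlgebra.single t (A.val i j))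
      rw [← hr, congrFun hw j, map_sum]
      simp only [Matrix.vecMul, dotProduct, Finset.mul_sum, map_mul, ← hr, mul_assoc]
      rfl)
    ext i
    have := hr i
    rw [hr0, Pi.zero_apply, map_zero] at this
    exact (IsUnit.mul_right_eq_zero (numerator_isUnit s)).1 this) w
  refine ⟨u, ?_⟩
  rw [← hu, Matrix.sub_mulVec, Matrix.one_mulVec]

end TwistedAux


set_option maxHeartbeats 1000000

/-- The maximal free abelian quotient of a group `G`: the abelianization of `G` modulo its
torsion subgroup. -/
abbrev maxFreeAbelianQuotient (G : Type*) [Group G] : Type _ :=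
  Abelianization G ⧸ CommGroup.torsion (Abelianization G)

/-- The canonical projection `q : G → G_fab` onto the maximal free abelian quotient. -/
def maxFreeAbelianProj (G : Type*) [Group G] : G →* maxFreeAbelianQuotient G :=
  (QuotientGroup.mk' (CommGroup.torsion (Abelianization G))).comp Abelianization.of

/-- Let `G` be a finitely generated group whose maximal free abelian quotient
`G_fab` is nontrivial, with canonical projection `q : G → G_fab`.  Let `D` be a division ring,
`n` a positive integer, and `σ : G → GL_n(D)` a group homomorphism.  Assume the group ring
`D[G_fab]` satisfies the Ore condition and let `K = Ore(D[G_fab])` be its Ore field of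
fractions.  Let `G` act on `K^n` by `g • v = σ(g)q(g) • v`, i.e. by left multiplication by the
matrix over `K` with entries `σ(g)_{ij}·q(g)`.  Then the additive subgroup of `K^n` generated
by `{v − g • v : g ∈ G, v ∈ K^n}` is all of `K^n` (the zeroth twisted homology vanishes). -/
theorem zeroth_twisted_homology_vanishes
    (G : Type*) [Group G] [Group.FG G] [Nontrivial (maxFreeAbelianQuotient G)]
    (D : Type*) [DivisionRing D] (n : ℕ) (hn : 0 < n)
    (σ : G →* (Matrix (Fin n) (Fin n) D)ˣ)
    [OreLocalization.OreSet (nonZeroDivisors (MonoidAlgebra D (maxFreeAbelianQuotient G)))] :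
    AddSubgroup.closure
      {w : Fin n →
          OreLocalization (nonZeroDivisors (MonoidAlgebra D (maxFreeAbelianQuotient G)))
            (MonoidAlgebra D (maxFreeAbelianQuotient G)) |
        ∃ g : G, ∃ v : Fin n →
            OreLocalization (nonZeroDivisors (MonoidAlgebra D (maxFreeAbelianQuotient G)))
              (MonoidAlgebra D (maxFreeAbelianQuotient G)),
          w = v - Matrix.mulVec
              (Matrix.of fun i j =>
                OreLocalization.numeratorRingHom
                  (MonoidAlgebra.single (maxFreeAbelianProj G g)
                    ((σ g).val i j))) v} = ⊤ := by
  rw [eq_top_iff]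
  intro w _
  apply AddSubgroup.subset_closure
  obtain ⟨t, ht⟩ := exists_ne (1 : maxFreeAbelianQuotient G)
  have hq : Function.Surjective (maxFreeAbelianProj G) :=
    (QuotientGroup.mk'_surjective _).comp (QuotientGroup.mk'_surjective _)
  obtain ⟨g, rfl⟩ := hq t
  have : Group.FG (maxFreeAbelianQuotient G) := Group.fg_of_surjective hq
  exact ⟨g, TwistedAux.main (σ g) _ ht w⟩
end

section
/- Let D be a division ring, n a positive integer, and H a finitely generated free abelian group. Assume the group ring D[H] satisfies the Ore condition and let K = Ore(D[H]) be its Ore field of fractions, with ι : D[H] → K the canonical embedding. Then for every invertible matrix A ∈ GL_n(D) and every h ∈ H with h ≠ 1, the n×n matrix over K whose (i,j) entry is δ_{ij} − A_{ij}·ι(h) (that is, the matrix Id − A·h) is invertible in M_n(K). -/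
set_option maxHeartbeats 1000000

/-- Common left denominators in an Ore localization. -/
theorem ore_common_denominator {R : Type*} [Ring R] (S : Submonoid R)
    [OreLocalization.OreSet S] {ι : Type*} (v : ι → OreLocalization S R) (T : Finset ι) :
    ∃ s : S, ∀ i ∈ T, ∃ r : R,
      OreLocalization.numeratorRingHom (S := S) (s : R) * v i =
        OreLocalization.numeratorRingHom r := by
  classical
  induction T using Finset.induction_on with
  | empty => exact ⟨1, by simp⟩
  | insert a T _ ih =>
    obtain ⟨s, hs⟩ := ih
    obtain ⟨r, t, hrt⟩ : ∃ (r : R) (t : S),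
        OreLocalization.numeratorRingHom (S := S) (t : R) * v a =
          OreLocalization.numeratorRingHom r := by
      induction v a using OreLocalization.ind with
      | _ r t => exact ⟨r, t, OreLocalization.mul_cancel⟩
    obtain ⟨r', s', h'⟩ : ∃ (r' : R) (s' : S), (s' : R) * (s : R) = r' * (t : R) :=
      ⟨_, _, OreLocalization.ore_eq (s : R) t⟩
    refine ⟨s' * s, fun i hi => ?_⟩
    rcases Finset.mem_insert.1 hi with rfl | hi
    · refine ⟨r' * r, ?_⟩
      rw [Submonoid.coe_mul, h', map_mul, mul_assoc, hrt, map_mul]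
    · obtain ⟨q, hq⟩ := hs i hi
      refine ⟨(s' : R) * q, ?_⟩
      rw [Submonoid.coe_mul, map_mul, mul_assoc, hq, map_mul]

/-- A row vector over the group ring fixed by `A·h` vanishes, for `h` of infinite order. -/
theorem row_fixed_eq_zero {D H ι : Type*} [Ring D] [Group H] [Fintype ι]
    (a : ι → ι → D) (h : H) (hh : Function.Injective fun m : ℕ => h ^ m)
    (w : ι → MonoidAlgebra D H)
    (hw : ∀ j, w j = ∑ i, w i * MonoidAlgebra.single h (a i j)) : w = 0 := by
  classical
  by_contra hne
  have step : ∀ g, (∃ j, (w j).coeff g ≠ 0) → ∃ j, (w j).coeff (g * h⁻¹) ≠ 0 := by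
    rintro g ⟨j, hj⟩
    by_contra hall
    push Not at hall
    apply hj
    rw [hw j]
    simp [MonoidAlgebra.coeff_sum, hall]
  obtain ⟨j, hj⟩ := Function.ne_iff.1 hne
  obtain ⟨g, hg⟩ : ∃ g, (w j).coeff g ≠ 0 := by
    by_contra hall
    push Not at hall
    exact hj (by ext g; simpa using hall g)
  have all : ∀ m : ℕ, ∃ j, (w j).coeff (g * (h ^ m)⁻¹) ≠ 0 := by
    intro m
    induction m with
    | zero => exact ⟨j, by simpa using hg⟩
    | succ m ih =>
      have := step _ ih
      rwa [mul_assoc, ← mul_inv_rev, ← pow_succ'] at this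
  have hfin : (⋃ j, {g | (w j).coeff g ≠ 0}).Finite :=
    Set.finite_iUnion fun j => (w j).coeff.finite_support
  refine Set.infinite_of_injective_forall_mem (f := fun m : ℕ => g * (h ^ m)⁻¹) ?_ ?_ hfin
  · intro x y hxy
    exact hh (by simpa using hxy)
  · intro m
    simpa using all m

/-- A square matrix over a division ring with trivial left kernel is a unit. -/
theorem matrix_isUnit_of_vecMul {K ι : Type*} [DivisionRing K] [Fintype ι] [DecidableEq ι]
    (M : Matrix ι ι K) (hM : ∀ v, Matrix.vecMul v M = 0 → v = 0) : IsUnit M := by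
  have hu : IsUnit (M.toLinearMapRight' : (ι → K) →ₗ[K] (ι → K)) := by
    rw [LinearMap.isUnit_iff_ker_eq_bot, LinearMap.ker_eq_bot']
    exact hM
  obtain ⟨u, hu⟩ := hu
  obtain ⟨N, hN⟩ := (Matrix.toLinearMapRight' (R := K) (m := ι) (n := ι)).surjective
    ((u⁻¹ : (Module.End K (ι → K))ˣ) : Module.End K (ι → K))
  refine ⟨⟨M, N, ?_, ?_⟩, rfl⟩
  · apply (Matrix.toLinearMapRight' (R := K) (m := ι) (n := ι)).injective
    rw [Matrix.toLinearMapRight'_mul, hN, ← hu, Matrix.toLinearMapRight'_one]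
    exact u.inv_mul
  · apply (Matrix.toLinearMapRight' (R := K) (m := ι) (n := ι)).injective
    rw [Matrix.toLinearMapRight'_mul, hN, ← hu, Matrix.toLinearMapRight'_one]
    exact u.mul_inv

/-- Let `D` be a division ring, `n` a positive integer, and `H` a finitely
generated free abelian group (a group isomorphic to `ℤ^k` for some `k`).  Assume the group ring
`D[H]` satisfies the Ore condition and let `K = Ore(D[H])` be its Ore field of fractions with
canonical embedding `ι`.  Then for every invertible matrix `A ∈ GL_n(D)` and every `h ∈ H` with
`h ≠ 1`, the matrix `Id − A·h` (with `(i,j)` entry `δ_{ij} − ι(A_{ij}·h)`) is invertible in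
`M_n(K)`. -/
theorem one_sub_unit_times_group_element_isUnit
    (D : Type*) [DivisionRing D] (n : ℕ) (hn : 0 < n)
    (H : Type*) [CommGroup H] (k : ℕ) (e : H ≃* Multiplicative (Fin k → ℤ))
    [OreLocalization.OreSet (nonZeroDivisors (MonoidAlgebra D H))]
    (A : (Matrix (Fin n) (Fin n) D)ˣ) (h : H) (hh : h ≠ 1) :
    IsUnit
      ((1 : Matrix (Fin n) (Fin n)
          (OreLocalization (nonZeroDivisors (MonoidAlgebra D H)) (MonoidAlgebra D H))) -
        Matrix.of fun i j =>
          OreLocalization.numeratorRingHom (MonoidAlgebra.single h (A.val i j))) := by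
  classical
  have hUP : UniqueProds H := e.uniqueProds_iff.mpr inferInstance
  have htf : Function.Injective fun m : ℕ => h ^ m := by
    intro x y hxy
    have h1 : e h ^ x = e h ^ y := by rw [← map_pow, ← map_pow]; exact congrArg e hxy
    have h2 : x • (e h).toAdd = y • (e h).toAdd := congrArg Multiplicative.toAdd h1
    have h3 : (e h).toAdd ≠ 0 := fun h0 => hh (e.injective (by
      rw [map_one]; exact h0))
    obtain ⟨i, hi⟩ := Function.ne_iff.1 h3
    have h4 := congrFun h2 i
    simp only [Pi.smul_apply, nsmul_eq_mul] at h4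
    exact_mod_cast mul_right_cancel₀ hi h4
  have hinj : Function.Injective (OreLocalization.numeratorRingHom
      (S := nonZeroDivisors (MonoidAlgebra D H))) :=
    OreLocalization.numeratorHom_inj (fun _ hx => hx.1)
  apply matrix_isUnit_of_vecMul
  intro v hv
  obtain ⟨s, hs⟩ := ore_common_denominator _ v Finset.univ
  choose w hw using fun i => hs i (Finset.mem_univ i)
  have hsu : IsUnit (OreLocalization.numeratorRingHom
      (S := nonZeroDivisors (MonoidAlgebra D H)) (s : MonoidAlgebra D H)) :=
    OreLocalization.numerator_isUnit s
  have hw0 : w = 0 := by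
    apply row_fixed_eq_zero (fun i j => A.val i j) h htf
    intro j
    apply hinj
    have hj := congrFun hv j
    have hj2 : v j = ∑ i, v i * OreLocalization.numeratorRingHom
        (MonoidAlgebra.single h (A.val i j)) := by
      rw [Matrix.vecMul_sub, Matrix.vecMul_one] at hj
      exact sub_eq_zero.1 hj
    rw [← hw j, hj2, Finset.mul_sum, map_sum]
    refine Finset.sum_congr rfl fun i _ => ?_
    rw [← mul_assoc, hw i, map_mul]
  funext i
  have := hw i
  rw [hw0, Pi.zero_apply, map_zero] at this
  exact hsu.mul_right_eq_zero.1 this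
end
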